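/- For every real v and every real ε with ε ≠ 4: det(A(v)) = 2v² − 1, and trace(adj(B^#(v, ε))·A(v)) = (3v/(ε − 4))·((8 + ε²)v² + ε² − 6ε − 4), where adj denotes the adjugate matrix. -/

import Mathlib

/-- `u = √(1 + v²)`. -/
noncomputable def uu (v : ℝ) : ℝ := Real.sqrt (1 + v ^ 2)

/-- The dissipation matrix `B^#(v, ε) = ε·B_visc − B₁ − (9ε/(4 − ε))·B₂`. -/
noncomputable def Bsharp (v ε : ℝ) : Matrix (Fin 2) (Fin 2) ℝ :=
  ε • !![(uu v) ^ 2 * v ^ 2, -(uu v) ^ 3 * v; -(uu v) ^ 3 * v, (uu v) ^ 4]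
    - !![16 * (uu v) ^ 2 * v ^ 2, -4 * (uu v) * v * (4 * v ^ 2 + 1);
         -4 * (uu v) * v * (4 * v ^ 2 + 1), (4 * v ^ 2 + 1) ^ 2]
    - (9 * ε / (4 - ε)) • !![((uu v) ^ 2 + v ^ 2) ^ 2, -2 * ((uu v) ^ 2 + v ^ 2) * (uu v) * v;
         -2 * ((uu v) ^ 2 + v ^ 2) * (uu v) * v, 4 * (uu v) ^ 2 * v ^ 2]

/-- The matrix `A(v)` of the scaled linearization. -/
noncomputable def Amat (v : ℝ) : Matrix (Fin 2) (Fin 2) ℝ :=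
  !![v * (6 * v ^ 2 + 5), -(uu v) * (6 * v ^ 2 + 1);
     -(uu v) * (6 * v ^ 2 + 1), 3 * v * (2 * v ^ 2 + 1)]

/-- `det A(v) = 2v² − 1` and
`trace(adj(B^#(v, ε))·A(v)) = (3v/(ε − 4))((8 + ε²)v² + ε² − 6ε − 4)`. -/
theorem det_Amat_trace_adj (v ε : ℝ) (hε : ε ≠ 4) :
    (Amat v).det = 2 * v ^ 2 - 1 ∧
    Matrix.trace ((Bsharp v ε).adjugate * Amat v) =
      3 * v / (ε - 4) * ((8 + ε ^ 2) * v ^ 2 + ε ^ 2 - 6 * ε - 4) := by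
  have hu : uu v ^ 2 = 1 + v ^ 2 := Real.sq_sqrt (by positivity)
  have hu4 : uu v ^ 4 = (1 + v ^ 2) ^ 2 := by rw [← hu]; ring
  have hε₀ : ε - 4 ≠ 0 := sub_ne_zero.mpr hε
  constructor
  · simp only [Amat, Matrix.det_fin_two_of]
    linear_combination -(6 * v ^ 2 + 1) ^ 2 * hu
  · have hc : 9 * ε / (4 - ε) = -(9 * ε / (ε - 4)) := by
      rw [← neg_sub ε 4, div_neg]
    simp only [Bsharp, Amat, hc, Matrix.trace_fin_two, Matrix.adjugate_fin_two, Matrix.mul_apply,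
      Fin.sum_univ_two, Matrix.sub_apply, Matrix.smul_apply, Matrix.of_apply, Matrix.cons_val_zero,
      Matrix.cons_val_one, Matrix.cons_val', Matrix.cons_val_fin_one, smul_eq_mul]
    field_simp
    ring_nf
    simp only [hu, hu4]
    ring
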